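/- Let μ be a Borel probability measure on a compact interval 𝕀 ⊂ ℝ of positive length, and n ∈ ℕ. For every p ∈ Π_n there exists a best Lévy-distance approximation of μ given p, i.e. x* ∈ Ξ_n minimizing x ↦ d_L(μ, δ_x^p). Moreover, for x ∈ Ξ_n one has d_L(μ, δ_x^p) = min_{y∈Ξ_n} d_L(μ, δ_y^p) if and only if for every j = 1,…,n with P_{j−1} < P_j it holds that ℓ_{F_μ⁻¹,[P_{j−1},P_j]}(x_j) ≤ L_•(p); and in this case d_L(μ, δ_x^p) = ω · L_•(p). -/

import Mathlib

open MeasureTheory Filter Set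

noncomputable section

namespace BenfordApprox

/-- Right-hand limit `f₊` of a nondecreasing `f : ℝ → ℝ̄`, at an extended-real point. -/
def fplus (f : ℝ → EReal) (a : EReal) : EReal := sInf (f '' {x : ℝ | a < (x : EReal)})

/-- Left-hand limit `f₋` of a nondecreasing `f : ℝ → ℝ̄`, at an extended-real point. -/
def fminus (f : ℝ → EReal) (a : EReal) : EReal := sSup (f '' {x : ℝ | (x : EReal) < a})

/-- The (upper) inverse function `f⁻¹(t) = sup {x : f x ≤ t}` (with `sup ∅ = ⊥`). -/
def upperInv (f : ℝ → EReal) (t : ℝ) : EReal :=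
  sSup ((fun x : ℝ => (x : EReal)) '' {x : ℝ | f x ≤ (t : EReal)})

/-- The upper inverse, for an extended-real argument. -/
def upperInvE (f : ℝ → EReal) (t : EReal) : EReal :=
  sSup ((fun x : ℝ => (x : EReal)) '' {x : ℝ | f x ≤ t})

/-- Lévy-type distance `d_L(f,g)` between nondecreasing functions `f g : ℝ → ℝ̄`. -/
def dLfun (f g : ℝ → EReal) : EReal :=
  sInf ((fun y : ℝ => (y : EReal)) ''
    {y : ℝ | 0 ≤ y ∧ ∀ x : ℝ, f (x - y) - (y : EReal) ≤ g x ∧ g x ≤ f (x + y) + (y : EReal)})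

/-- The auxiliary function `ℓ_{f,I}`; it depends on `I` only through `lo = inf I`, `hi = sup I`. -/
def ell (f : ℝ → EReal) (lo hi : EReal) (x : ℝ) : ℝ :=
  sInf {y : ℝ | 0 ≤ y ∧ fminus f (hi - (y : EReal)) - (y : EReal) ≤ (x : EReal) ∧
    (x : EReal) ≤ fplus f (lo + (y : EReal)) + (y : EReal)}

/-- The minimal value `ℓ*_{f,I} = min {y ≥ 0 : f₋(sup I − y) − y ≤ f₊(inf I + y) + y}`. -/
def ellStar (f : ℝ → EReal) (lo hi : EReal) : ℝ :=
  sInf {y : ℝ | 0 ≤ y ∧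
    fminus f (hi - (y : EReal)) - (y : EReal) ≤ fplus f (lo + (y : EReal)) + (y : EReal)}

/-- Distribution function `F_μ(t) = μ {y ∈ 𝕀 : y ≤ t}` of `μ`, where `𝕀 = [A,B]`. -/
def cdf (μ : Measure ℝ) (A B : ℝ) (t : ℝ) : ℝ := (μ (Icc A B ∩ Iic t)).toReal

/-- `F_μ` evaluated at an extended-real point (so `F_μ(−∞) = 0`, `F_μ(+∞) = 1`). -/
def cdfE (μ : Measure ℝ) (A B : ℝ) (a : EReal) : ℝ :=
  (μ (Icc A B ∩ {y : ℝ | (y : EReal) ≤ a})).toReal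

/-- Left limit `F_{μ−}` at an extended-real point (so `F_{μ−}(−∞) = 0`, `F_{μ−}(+∞) = 1`). -/
def cdfL (μ : Measure ℝ) (A B : ℝ) (a : EReal) : ℝ :=
  sSup ((cdf μ A B) '' {t : ℝ | (t : EReal) < a})

/-- Left limit `F_{μ−}` at a real point. -/
def cdfm (μ : Measure ℝ) (A B : ℝ) (t : ℝ) : ℝ := sSup ((cdf μ A B) '' Iio t)

/-- The (upper) quantile function `F_μ⁻¹` of `μ` on `𝕀 = [A,B]`, extended monotonically to `ℝ`. -/
def quant (μ : Measure ℝ) (A B : ℝ) (t : ℝ) : ℝ :=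
  if t < (μ {A}).toReal ∨ t < 0 then A
  else sSup {y ∈ Icc A B | cdf μ A B y ≤ t}

/-- Left limit `F⁻¹_{μ−}` of the quantile function. -/
def quantm (μ : Measure ℝ) (A B : ℝ) (t : ℝ) : ℝ := sSup ((quant μ A B) '' Iio t)

/-- `F_μ` as a function into the extended reals. -/
def cdfEReal (μ : Measure ℝ) (A B : ℝ) : ℝ → EReal := fun t => ((cdf μ A B t : ℝ) : EReal)

/-- `F_μ⁻¹` as a function into the extended reals. -/
def quantEReal (μ : Measure ℝ) (A B : ℝ) : ℝ → EReal := fun t => ((quant μ A B t : ℝ) : EReal)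

/-- The finitely supported measure `δ_x^p = Σ_j p_j δ_{x_j}`. -/
def discr (n : ℕ) (x p : Fin n → ℝ) : Measure ℝ :=
  ∑ j : Fin n, ENNReal.ofReal (p j) • Measure.dirac (x j)

/-- `p ∈ Π_n`: a probability vector. -/
def IsPi (n : ℕ) (p : Fin n → ℝ) : Prop := (∀ j, 0 ≤ p j) ∧ ∑ j, p j = 1

/-- `x ∈ Ξ_n`: a nondecreasing vector of locations in `𝕀 = [A,B]`. -/
def IsXi (A B : ℝ) (n : ℕ) (x : Fin n → ℝ) : Prop := (∀ j, x j ∈ Icc A B) ∧ Monotone x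

/-- The uniform weight vector `u_n = (1/n, …, 1/n)`. -/
def unif (n : ℕ) : Fin n → ℝ := fun _ => 1 / (n : ℝ)

/-- Partial sums `P_i = Σ_{j<i} p_j` (so `P_0 = 0`, `P_n = 1`). -/
def psum (n : ℕ) (p : Fin n → ℝ) (i : ℕ) : ℝ := ∑ j : Fin n, if (j : ℕ) < i then p j else 0

/-- Locations extended by `x_0 = −∞`, `x_{n+1} = +∞`; here `extPts n x j` is the paper's `x_j`. -/
def extPts (n : ℕ) (x : Fin n → ℝ) : ℕ → EReal := fun j =>
  if hj : j = 0 then ⊥ else if h : j ≤ n then ((x ⟨j - 1, by omega⟩ : ℝ) : EReal) else ⊤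

/-- `xcoord n x j` is the paper's `x_{j+1}` (0-based access). -/
def xcoord (n : ℕ) (x : Fin n → ℝ) (j : ℕ) : ℝ := if h : j < n then x ⟨j, h⟩ else 0

/-- The normalizing constant `ω = max{1, λ(𝕀)}/λ(𝕀)` for `𝕀 = [A,B]`. -/
def omegaI (A B : ℝ) : ℝ := max 1 (B - A) / (B - A)

/-- Lévy distance between Borel measures on `𝕀 = [A,B]`. -/
def dLevy (A B : ℝ) (μ ν : Measure ℝ) : ℝ :=
  omegaI A B * sInf {y : ℝ | 0 ≤ y ∧
    ∀ t : ℝ, cdf μ A B (t - y) - y ≤ cdf ν A B t ∧ cdf ν A B t ≤ cdf μ A B (t + y) + y}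

/-- Kolmogorov (uniform) distance between Borel measures on `𝕀 = [A,B]`. -/
def dKol (A B : ℝ) (μ ν : Measure ℝ) : ℝ :=
  sSup (Set.range fun t : ℝ => |cdf μ A B t - cdf ν A B t|)

/-- `L¹`-Kantorovich distance between Borel measures on `𝕀 = [A,B]`. -/
def dKant1 (A B : ℝ) (μ ν : Measure ℝ) : ℝ :=
  (B - A)⁻¹ * ∫ y in Ioo (0 : ℝ) 1, |quant μ A B y - quant ν A B y|

/-- `L^r`-Kantorovich distance between Borel measures on `𝕀 = [A,B]`. -/
def dKant (A B r : ℝ) (μ ν : Measure ℝ) : ℝ :=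
  (B - A)⁻¹ * (∫ y in Ioo (0 : ℝ) 1, |quant μ A B y - quant ν A B y| ^ r) ^ (1 / r)

/-- The Benford measure `β_b` on `[1,b]`: the law of `b^U` with `U` uniform on `[0,1)`. -/
def benford (b : ℝ) : Measure ℝ := (volume.restrict (Ico (0 : ℝ) 1)).map (fun t : ℝ => b ^ t)

/-- The map `T_{f,a}(x) = f₊(f⁻¹(x+a) + 2a) + a`. -/
def Tmap (f : ℝ → EReal) (a : ℝ) : EReal → EReal :=
  fun x => fplus f (upperInvE f (x + (a : EReal)) + ((2 * a : ℝ) : EReal)) + (a : EReal)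

/-- The map `S_{f,a}(x) = f₊(f⁻¹(x+a)) + a`. -/
def Smap (f : ℝ → EReal) (a : ℝ) : EReal → EReal :=
  fun x => fplus f (upperInvE f (x + (a : EReal))) + (a : EReal)

/-- `L_•^{•,n} = min {a ≥ 0 : T_{F_μ,a}^{[n]}(0) ≥ 1}`. -/
def LBB (μ : Measure ℝ) (A B : ℝ) (n : ℕ) : ℝ :=
  sInf {a : ℝ | 0 ≤ a ∧ (1 : EReal) ≤ (Tmap (cdfEReal μ A B) a)^[n] ((0 : ℝ) : EReal)}

/-- `K_•^{•,n} = min {a ≥ 0 : S_{F_μ,a}^{[n]}(0) ≥ 1}`. -/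
def KBB (μ : Measure ℝ) (A B : ℝ) (n : ℕ) : ℝ :=
  sInf {a : ℝ | 0 ≤ a ∧ (1 : EReal) ≤ (Smap (cdfEReal μ A B) a)^[n] ((0 : ℝ) : EReal)}


/-- `L_•(p) = max_{j=1,…,n} ℓ*_{F_μ⁻¹,[P_{j−1},P_j]}`. -/
def Lwei (μ : Measure ℝ) (A B : ℝ) (n : ℕ) (hn : 0 < n) (p : Fin n → ℝ) : ℝ :=
  Finset.sup' Finset.univ ⟨⟨0, hn⟩, Finset.mem_univ _⟩
    fun j : Fin n => ellStar (quantEReal μ A B)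
      ((psum n p (j : ℕ) : ℝ) : EReal) ((psum n p ((j : ℕ) + 1) : ℝ) : EReal)

section Distribution

variable {A B : ℝ} {μ : Measure ℝ}

lemma cdf_nonneg (t : ℝ) : 0 ≤ cdf μ A B t := ENNReal.toReal_nonneg

lemma cdf_of_lt {t : ℝ} (ht : t < A) : cdf μ A B t = 0 := by
  have : Icc A B ∩ Iic t = ∅ := by
    ext y
    simp only [mem_inter_iff, mem_Icc, mem_Iic, mem_empty_iff_false, iff_false]
    intro h
    linarith [h.1.1, h.2]
  simp [cdf, this]

lemma cdf_of_le (hμ : μ (Icc A B) = 1) {t : ℝ} (ht : B ≤ t) : cdf μ A B t = 1 := by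
  have : Icc A B ∩ Iic t = Icc A B := inter_eq_left.2 fun y hy => hy.2.trans ht
  simp [cdf, this, hμ]

lemma cdf_left (hAB : A < B) : cdf μ A B A = (μ {A}).toReal := by
  have : Icc A B ∩ Iic A = {A} := by
    ext y
    simp only [mem_inter_iff, mem_Icc, mem_Iic, mem_singleton_iff]
    constructor
    · exact fun h => le_antisymm h.2 h.1.1
    · rintro rfl
      exact ⟨⟨le_rfl, hAB.le⟩, le_rfl⟩
  rw [cdf, this]

lemma left_mem_sublevel (hAB : A < B) {t : ℝ} (ht : ¬(t < (μ {A}).toReal ∨ t < 0)) :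
    A ∈ {y ∈ Icc A B | cdf μ A B y ≤ t} := by
  push Not at ht
  exact ⟨left_mem_Icc.2 hAB.le, (cdf_left hAB).trans_le ht.1⟩

lemma bddAbove_sublevel (t : ℝ) : BddAbove {y ∈ Icc A B | cdf μ A B y ≤ t} :=
  ⟨B, fun _ hy => hy.1.2⟩

lemma quant_mem (hAB : A < B) (t : ℝ) : quant μ A B t ∈ Icc A B := by
  unfold quant
  split_ifs with h
  · exact left_mem_Icc.2 hAB.le
  · exact ⟨le_csSup (bddAbove_sublevel t) (left_mem_sublevel hAB h),
      csSup_le ⟨A, left_mem_sublevel hAB h⟩ fun _ hy => hy.1.2⟩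

variable [IsProbabilityMeasure μ]

lemma cdf_mono : Monotone (cdf μ A B) := fun _ _ h =>
  ENNReal.toReal_mono (measure_ne_top _ _)
    (measure_mono (inter_subset_inter_right _ (Iic_subset_Iic.2 h)))

lemma cdf_le_one (t : ℝ) : cdf μ A B t ≤ 1 := measureReal_le_one

lemma cdf_eq (hμ : μ (Icc A B) = 1) : cdf μ A B = ProbabilityTheory.cdf μ := by
  funext t
  have h : μ (Icc A B)ᶜ = 0 := (prob_compl_eq_zero_iff measurableSet_Icc).2 hμ
  rw [ProbabilityTheory.cdf_eq_real, cdf, inter_comm, measure_inter_conull h, Measure.real]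

/-- Right-continuity of the distribution function, in the form used below. -/
lemma exists_gt_cdf_lt (hμ : μ (Icc A B) = 1) {t c : ℝ} (h : cdf μ A B t < c) :
    ∃ u, t < u ∧ cdf μ A B u < c := by
  rw [cdf_eq hμ] at h ⊢
  have hc := ((ProbabilityTheory.cdf μ).right_continuous t).mono Ioi_subset_Ici_self
  obtain ⟨u, hu, hlt⟩ := ((hc.eventually_lt_const h).and self_mem_nhdsWithin).exists
  exact ⟨u, hlt, hu⟩

lemma le_quant (hAB : A < B) {u s : ℝ} (hu : u ∈ Icc A B) (h : cdf μ A B u ≤ s) :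
    u ≤ quant μ A B s := by
  have hA : (μ {A}).toReal ≤ s := (cdf_left hAB).symm.trans_le ((cdf_mono hu.1).trans h)
  have h0 : 0 ≤ s := (cdf_nonneg u).trans h
  rw [quant, if_neg (by push Not; exact ⟨hA, h0⟩)]
  exact le_csSup (bddAbove_sublevel s) ⟨hu, h⟩

lemma quant_mono (hAB : A < B) : Monotone (quant μ A B) := by
  intro s s' h
  by_cases hs : s < (μ {A}).toReal ∨ s < 0
  · rw [quant, if_pos hs]
    exact (quant_mem hAB s').1
  · rw [quant, if_neg hs]
    exact csSup_le ⟨A, left_mem_sublevel hAB hs⟩ fun y hy => le_quant hAB hy.1 (hy.2.trans h)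

lemma cdf_le_of_lt_quant (hAB : A < B) {u s : ℝ} (hs : 0 ≤ s) (h : u < quant μ A B s) :
    cdf μ A B u ≤ s := by
  unfold quant at h
  split_ifs at h with hc
  · exact (cdf_of_lt h).trans_le hs
  · obtain ⟨v, hv, huv⟩ := exists_lt_of_lt_csSup ⟨A, left_mem_sublevel hAB hc⟩ h
    exact (cdf_mono huv.le).trans hv.2

lemma quant_le_of_lt_cdf (hAB : A < B) {v s : ℝ} (hv : A ≤ v) (h : s < cdf μ A B v) :
    quant μ A B s ≤ v := by
  unfold quant
  split_ifs with hc
  · exact hv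
  · refine csSup_le ⟨A, left_mem_sublevel hAB hc⟩ fun y hy => ?_
    by_contra! hlt
    exact absurd (h.trans_le (cdf_mono hlt.le)) (not_lt.2 hy.2)

end Distribution

section PartialSums

variable {n : ℕ} {p : Fin n → ℝ}

lemma psum_succ (j : Fin n) : psum n p ((j : ℕ) + 1) = psum n p j + p j := by
  have h : p j = ∑ k : Fin n, if k = j then p k else 0 := by simp
  conv_rhs => rw [h]
  unfold psum
  rw [← Finset.sum_add_distrib]
  refine Finset.sum_congr rfl fun k _ => ?_
  rcases lt_trichotomy k j with hk | hk | hk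
  · have : (k : ℕ) < j := hk
    simp [this, hk.ne, Nat.lt_succ_of_lt this]
  · simp [hk]
  · have : (j : ℕ) < k := hk
    simp [hk.ne', not_lt.2 this.le, not_lt.2 (Nat.succ_le_of_lt this)]

lemma psum_mono (hp : IsPi n p) : Monotone (psum n p) := by
  intro i k hik
  refine Finset.sum_le_sum fun j _ => ?_
  have := hp.1 j
  split_ifs <;> first | lia | linarith

lemma psum_nonneg (hp : IsPi n p) (i : ℕ) : 0 ≤ psum n p i :=
  Finset.sum_nonneg fun j _ => by
    have := hp.1 j
    split_ifs <;> simp [this]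

lemma psum_le_one (hp : IsPi n p) (i : ℕ) : psum n p i ≤ 1 := by
  rw [← hp.2]
  refine Finset.sum_le_sum fun j _ => ?_
  have := hp.1 j
  split_ifs <;> simp [this]

variable {A B : ℝ} {x : Fin n → ℝ}

lemma cdf_discr (hp : IsPi n p) (hx : IsXi A B n x) (t : ℝ) :
    cdf (discr n x p) A B t = ∑ j, if x j ≤ t then p j else 0 := by
  have hm : MeasurableSet (Icc A B ∩ Iic t) := measurableSet_Icc.inter measurableSet_Iic
  simp only [cdf, discr, Measure.coe_finsetSum, Finset.sum_apply, Measure.smul_apply, smul_eq_mul,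
    Measure.dirac_apply' _ hm]
  rw [ENNReal.toReal_sum]
  · refine Finset.sum_congr rfl fun j _ => ?_
    by_cases h : x j ≤ t
    · have : x j ∈ Icc A B ∩ Iic t := ⟨hx.1 j, h⟩
      simp [indicator_of_mem this, h, hp.1 j]
    · simp [h]
  · intro j _
    by_cases h : x j ∈ Icc A B ∩ Iic t
    · simp [indicator_of_mem h]
    · simp [indicator_of_notMem h]

lemma cdf_discr_le_psum (hp : IsPi n p) (hx : IsXi A B n x) {j : Fin n} {t : ℝ} (h : t < x j) :
    cdf (discr n x p) A B t ≤ psum n p j := by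
  rw [cdf_discr hp hx]
  refine Finset.sum_le_sum fun k _ => ?_
  have hk := hp.1 k
  by_cases hkt : x k ≤ t
  · have : k < j := by
      by_contra! hjk
      linarith [hx.2 hjk]
    have : (k : ℕ) < j := this
    simp [hkt, this]
  · rw [if_neg hkt]
    split_ifs <;> simp [hk]

lemma psum_succ_le_cdf_discr (hp : IsPi n p) (hx : IsXi A B n x) {j : Fin n} {t : ℝ}
    (h : x j ≤ t) : psum n p ((j : ℕ) + 1) ≤ cdf (discr n x p) A B t := by
  rw [cdf_discr hp hx]
  refine Finset.sum_le_sum fun k _ => ?_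
  have hk := hp.1 k
  by_cases hkj : (k : ℕ) < j + 1
  · have : k ≤ j := Nat.lt_succ_iff.1 hkj
    simp [hkj, (hx.2 this).trans h]
  · rw [if_neg hkj]
    split_ifs <;> simp [hk]

lemma one_le_cdf_discr_or (hp : IsPi n p) (hx : IsXi A B n x) (t : ℝ) :
    1 ≤ cdf (discr n x p) A B t ∨
      ∃ j : Fin n, 0 < p j ∧ t < x j ∧ psum n p j ≤ cdf (discr n x p) A B t := by
  rw [cdf_discr hp hx]
  rcases (Finset.univ.filter fun j : Fin n => 0 < p j ∧ t < x j).eq_empty_or_nonempty with h | h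
  · left
    rw [← hp.2]
    refine Finset.sum_le_sum fun k _ => ?_
    have hk : ¬(0 < p k ∧ t < x k) := by
      simpa using Finset.filter_eq_empty_iff.1 h (Finset.mem_univ k)
    split_ifs with hkt
    · exact le_rfl
    · exact not_lt.1 fun hpos => hk ⟨hpos, not_le.1 hkt⟩
  · right
    obtain ⟨j, hj⟩ := Finset.exists_minimal h
    have hj' := (Finset.mem_filter.1 hj.prop).2
    refine ⟨j, hj'.1, hj'.2, Finset.sum_le_sum fun k _ => ?_⟩
    have hk := hp.1 k
    by_cases hkj : (k : ℕ) < j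
    · rw [if_pos hkj]
      split_ifs with hkt
      · exact le_rfl
      · refine not_lt.1 fun hpos => ?_
        have : k ∈ Finset.univ.filter fun j : Fin n => 0 < p j ∧ t < x j := by
          simpa using ⟨hpos, not_le.1 hkt⟩
        exact hj.not_lt this hkj
    · rw [if_neg hkj]
      split_ifs <;> simp [hk]

lemma cdf_discr_le_zero_or (hp : IsPi n p) (hx : IsXi A B n x) (t : ℝ) :
    cdf (discr n x p) A B t ≤ 0 ∨
      ∃ j : Fin n, 0 < p j ∧ x j ≤ t ∧ cdf (discr n x p) A B t ≤ psum n p ((j : ℕ) + 1) := by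
  rw [cdf_discr hp hx]
  rcases (Finset.univ.filter fun j : Fin n => 0 < p j ∧ x j ≤ t).eq_empty_or_nonempty with h | h
  · left
    refine Finset.sum_nonpos fun k _ => ?_
    have hk : ¬(0 < p k ∧ x k ≤ t) := by
      simpa using Finset.filter_eq_empty_iff.1 h (Finset.mem_univ k)
    split_ifs with hkt
    · exact not_lt.1 fun hpos => hk ⟨hpos, hkt⟩
    · exact le_rfl
  · right
    obtain ⟨j, hj⟩ := Finset.exists_maximal h
    have hj' := (Finset.mem_filter.1 hj.prop).2
    refine ⟨j, hj'.1, hj'.2, Finset.sum_le_sum fun k _ => ?_⟩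
    have hk := hp.1 k
    by_cases hkj : (k : ℕ) < j + 1
    · rw [if_pos hkj]
      split_ifs <;> simp [hk]
    · rw [if_neg hkj]
      split_ifs with hkt
      · refine not_lt.1 fun hpos => ?_
        have : k ∈ Finset.univ.filter fun j : Fin n => 0 < p j ∧ x j ≤ t := by
          simpa using ⟨hpos, hkt⟩
        refine hj.not_gt this ?_
        exact Fin.lt_def.2 (by lia)
      · exact le_rfl

end PartialSums

section Infima

/-- The condition defining `ℓ_{f,[lo,hi]}(x) ≤ y` for real-valued `f`. -/
def EllCond (f : ℝ → ℝ) (lo hi x y : ℝ) : Prop :=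
  0 ≤ y ∧ (∀ s < hi - y, f s - y ≤ x) ∧ ∀ s > lo + y, x ≤ f s + y

/-- The condition defining `ℓ*_{f,[lo,hi]} ≤ y` for real-valued `f`. -/
def EllStarCond (f : ℝ → ℝ) (lo hi y : ℝ) : Prop :=
  0 ≤ y ∧ ∀ s < hi - y, ∀ s' > lo + y, f s - y ≤ f s' + y

lemma ell_eq (f : ℝ → ℝ) (lo hi x : ℝ) :
    ell (fun t => (f t : EReal)) lo hi x = sInf {y | EllCond f lo hi x y} := by
  unfold ell EllCond
  congr 1
  ext y
  have h1 : fminus (fun t => (f t : EReal)) ((hi : EReal) - (y : EReal)) - (y : EReal) ≤ (x : EReal)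
      ↔ ∀ s < hi - y, f s - y ≤ x := by
    rw [EReal.sub_le_iff_le_add (by simp) (by simp), fminus, sSup_le_iff, forall_mem_image]
    simp only [mem_ofPred_eq, ← EReal.coe_sub, ← EReal.coe_add, EReal.coe_lt_coe_iff,
      EReal.coe_le_coe_iff, sub_le_iff_le_add]
  have h2 : (x : EReal) ≤ fplus (fun t => (f t : EReal)) ((lo : EReal) + (y : EReal)) + (y : EReal)
      ↔ ∀ s > lo + y, x ≤ f s + y := by
    rw [← EReal.sub_le_iff_le_add (by simp) (by simp), fplus, le_sInf_iff, forall_mem_image]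
    simp only [mem_ofPred_eq, ← EReal.coe_sub, ← EReal.coe_add, EReal.coe_lt_coe_iff,
      EReal.coe_le_coe_iff, sub_le_iff_le_add, gt_iff_lt]
  simp only [mem_ofPred_eq, h1, h2]

lemma ellStar_eq (f : ℝ → ℝ) (lo hi : ℝ) :
    ellStar (fun t => (f t : EReal)) lo hi = sInf {y | EllStarCond f lo hi y} := by
  unfold ellStar EllStarCond
  congr 1
  ext y
  have h : fminus (fun t => (f t : EReal)) ((hi : EReal) - (y : EReal)) - (y : EReal) ≤
      fplus (fun t => (f t : EReal)) ((lo : EReal) + (y : EReal)) + (y : EReal)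
      ↔ ∀ s < hi - y, ∀ s' > lo + y, f s - y ≤ f s' + y := by
    rw [EReal.sub_le_iff_le_add (by simp) (by simp), fminus, sSup_le_iff, forall_mem_image]
    simp only [mem_ofPred_eq, ← EReal.coe_sub, EReal.coe_lt_coe_iff]
    refine forall₂_congr fun s _ => ?_
    rw [← EReal.sub_le_iff_le_add (by simp) (by simp),
      ← EReal.sub_le_iff_le_add (by simp) (by simp), fplus, le_sInf_iff, forall_mem_image]
    simp only [mem_ofPred_eq, ← EReal.coe_sub, ← EReal.coe_add, EReal.coe_lt_coe_iff,
      EReal.coe_le_coe_iff, sub_le_iff_le_add, gt_iff_lt]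
  simp only [mem_ofPred_eq, h]

lemma sInf_le_iff_of_approx {P : ℝ → Prop} (hne : ∃ y, P y) (h0 : ∀ y, P y → 0 ≤ y)
    (hcl : ∀ a, (∀ ε > 0, ∃ b, P b ∧ b < a + ε) → P a) {a : ℝ} : sInf {y | P y} ≤ a ↔ P a :=
  ⟨fun h => hcl a fun ε hε => exists_lt_of_csInf_lt (s := {y | P y}) hne (by linarith),
    fun h => csInf_le ⟨0, h0⟩ h⟩

variable {f : ℝ → ℝ} {lo hi x a : ℝ}

lemma EllCond.of_approx (h : ∀ ε > 0, ∃ b, EllCond f lo hi x b ∧ b < a + ε) :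
    EllCond f lo hi x a := by
  refine ⟨le_of_forall_pos_le_add fun ε hε => ?_, fun s hs => le_of_forall_pos_le_add fun ε hε => ?_,
    fun s hs => le_of_forall_pos_le_add fun ε hε => ?_⟩
  · obtain ⟨b, hb, hlt⟩ := h ε hε
    exact hb.1.trans hlt.le
  · obtain ⟨b, hb, hlt⟩ := h (min ε (hi - a - s)) (lt_min hε (by linarith))
    have h1 := min_le_left ε (hi - a - s)
    have h2 := min_le_right ε (hi - a - s)
    linarith [hb.2.1 s (by linarith)]
  · obtain ⟨b, hb, hlt⟩ := h (min ε (s - lo - a)) (lt_min hε (by linarith))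
    have h1 := min_le_left ε (s - lo - a)
    have h2 := min_le_right ε (s - lo - a)
    linarith [hb.2.2 s (by linarith)]

lemma EllStarCond.of_approx (h : ∀ ε > 0, ∃ b, EllStarCond f lo hi b ∧ b < a + ε) :
    EllStarCond f lo hi a := by
  refine ⟨le_of_forall_pos_le_add fun ε hε => ?_,
    fun s hs s' hs' => le_of_forall_pos_le_add fun ε hε => ?_⟩
  · obtain ⟨b, hb, hlt⟩ := h ε hε
    exact hb.1.trans hlt.le
  · obtain ⟨b, hb, hlt⟩ := h (min (ε / 2) (min (hi - a - s) (s' - lo - a)))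
      (lt_min (by linarith) (lt_min (by linarith) (by linarith)))
    have h1 := min_le_left (ε / 2) (min (hi - a - s) (s' - lo - a))
    have h2 := min_le_right (ε / 2) (min (hi - a - s) (s' - lo - a))
    have h3 := min_le_left (hi - a - s) (s' - lo - a)
    have h4 := min_le_right (hi - a - s) (s' - lo - a)
    linarith [hb.2 s (by linarith) s' (by linarith)]

variable {A B : ℝ}

lemma ellCond_length (hf : ∀ t, f t ∈ Icc A B) (hx : x ∈ Icc A B) :
    EllCond f lo hi x (B - A) :=
  ⟨by linarith [hx.1, hx.2], fun s _ => by linarith [(hf s).2, hx.1],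
    fun s _ => by linarith [(hf s).1, hx.2]⟩

lemma ell_le_iff (hf : ∀ t, f t ∈ Icc A B) (hx : x ∈ Icc A B) :
    ell (fun t => (f t : EReal)) lo hi x ≤ a ↔ EllCond f lo hi x a := by
  rw [ell_eq]
  exact sInf_le_iff_of_approx ⟨B - A, ellCond_length hf hx⟩ (fun _ hy => hy.1)
    fun a h => EllCond.of_approx h

lemma ellStar_le_iff (hf : ∀ t, f t ∈ Icc A B) :
    ellStar (fun t => (f t : EReal)) lo hi ≤ a ↔ EllStarCond f lo hi a := by
  have hA : A ≤ B := (hf 0).1.trans (hf 0).2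
  rw [ellStar_eq]
  refine sInf_le_iff_of_approx ⟨B - A, by linarith, fun s _ s' _ => ?_⟩ (fun _ hy => hy.1)
    fun a h => EllStarCond.of_approx h
  linarith [(hf s).2, (hf s').1]

lemma EllCond.ellStarCond (h : EllCond f lo hi x a) : EllStarCond f lo hi a :=
  ⟨h.1, fun s hs s' hs' => (h.2.1 s hs).trans (h.2.2 s' hs')⟩

end Infima

section Levy

variable {A B : ℝ} {μ : Measure ℝ} {n : ℕ} {p x : Fin n → ℝ}

lemma Lwei_le_iff (hAB : A < B) (hn : 0 < n) {a : ℝ} : Lwei μ A B n hn p ≤ a ↔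
    ∀ j : Fin n, EllStarCond (quant μ A B) (psum n p j) (psum n p ((j : ℕ) + 1)) a := by
  refine (Finset.sup'_le_iff _ _).trans ?_
  simp only [Finset.mem_univ, true_imp_iff]
  exact forall_congr' fun j => ellStar_le_iff (quant_mem hAB)

variable [IsProbabilityMeasure μ]

lemma cdf_sub_le_iff (hAB : A < B) (hp : IsPi n p) (hx : IsXi A B n x) {y : ℝ} (hy : 0 ≤ y) :
    (∀ t, cdf μ A B (t - y) - y ≤ cdf (discr n x p) A B t) ↔
      ∀ j, 0 < p j → ∀ s > psum n p j + y, x j ≤ quant μ A B s + y := by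
  constructor
  · intro h j _ s hs
    rw [← sub_le_iff_le_add]
    refine le_of_forall_lt fun u hu => ?_
    obtain ⟨v, huv, hv⟩ := exists_between hu
    refine huv.trans_le ?_
    rcases lt_or_ge v A with hvA | hvA
    · exact hvA.le.trans (quant_mem hAB s).1
    · refine le_quant hAB ⟨hvA, by linarith [(hx.1 j).2]⟩ ?_
      have h1 := h (v + y)
      have h2 := cdf_discr_le_psum hp hx (show v + y < x j by linarith)
      rw [add_sub_cancel_right] at h1
      linarith
  · intro h t
    rcases one_le_cdf_discr_or hp hx t with h1 | ⟨j, hj, htj, hle⟩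
    · linarith [cdf_le_one (μ := μ) (A := A) (B := B) (t - y)]
    · have : cdf μ A B (t - y) ≤ psum n p j + y := by
        refine le_of_forall_gt_imp_ge_of_dense fun s hs => ?_
        have h0 := psum_nonneg hp (j : ℕ)
        exact cdf_le_of_lt_quant hAB (by linarith) (by linarith [h j hj s hs])
      linarith

lemma cdf_discr_le_iff (hAB : A < B) (hμ : μ (Icc A B) = 1) (hp : IsPi n p) (hx : IsXi A B n x)
    {y : ℝ} (hy : 0 ≤ y) :
    (∀ t, cdf (discr n x p) A B t ≤ cdf μ A B (t + y) + y) ↔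
      ∀ j : Fin n, 0 < p j → ∀ s < psum n p ((j : ℕ) + 1) - y, quant μ A B s - y ≤ x j := by
  constructor
  · intro h j _ s hs
    rw [sub_le_iff_le_add]
    refine quant_le_of_lt_cdf hAB (by linarith [(hx.1 j).1]) ?_
    linarith [h (x j), psum_succ_le_cdf_discr hp hx (le_refl (x j))]
  · intro h t
    rcases cdf_discr_le_zero_or hp hx t with h0 | ⟨j, hj, hjt, hle⟩
    · linarith [cdf_nonneg (μ := μ) (A := A) (B := B) (t + y)]
    · by_contra! hlt
      obtain ⟨u, hu, hcu⟩ := exists_gt_cdf_lt (c := psum n p ((j : ℕ) + 1) - y) hμ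
        (show cdf μ A B (t + y) < _ by linarith)
      have hP := psum_le_one hp ((j : ℕ) + 1)
      have huB : u ≤ B := by
        by_contra! hB
        linarith [cdf_of_le hμ hB.le]
      have h1 := le_quant hAB ⟨by linarith [(hx.1 j).1], huB⟩ (le_refl (cdf μ A B u))
      linarith [h j hj _ hcu]

/-- The Lévy distance without the normalizing factor. -/
def levyInf (A B : ℝ) (μ ν : Measure ℝ) : ℝ :=
  sInf {y : ℝ | 0 ≤ y ∧
    ∀ t : ℝ, cdf μ A B (t - y) - y ≤ cdf ν A B t ∧ cdf ν A B t ≤ cdf μ A B (t + y) + y}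

lemma levyInf_le_iff (hAB : A < B) (hμ : μ (Icc A B) = 1) (hp : IsPi n p) (hx : IsXi A B n x)
    {a : ℝ} : levyInf A B μ (discr n x p) ≤ a ↔
      ∀ j : Fin n, 0 < p j →
        EllCond (quant μ A B) (psum n p j) (psum n p ((j : ℕ) + 1)) (x j) a := by
  have hpos : ∃ j, 0 < p j := by
    by_contra! h
    linarith [hp.2, Finset.sum_nonpos fun j (_ : j ∈ Finset.univ) => h j]
  obtain ⟨i, hi⟩ := hpos
  have hset : {y : ℝ | 0 ≤ y ∧ ∀ t : ℝ, cdf μ A B (t - y) - y ≤ cdf (discr n x p) A B t ∧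
      cdf (discr n x p) A B t ≤ cdf μ A B (t + y) + y} = {y | ∀ j : Fin n, 0 < p j →
        EllCond (quant μ A B) (psum n p j) (psum n p ((j : ℕ) + 1)) (x j) y} := by
    ext y
    simp only [mem_ofPred_eq, forall_and]
    constructor
    · rintro ⟨hy, h1, h2⟩ j hj
      exact ⟨hy, (cdf_discr_le_iff hAB hμ hp hx hy).1 h2 j hj,
        (cdf_sub_le_iff hAB hp hx hy).1 h1 j hj⟩
    · intro h
      have hy := (h i hi).1
      exact ⟨hy, (cdf_sub_le_iff hAB hp hx hy).2 fun j hj => (h j hj).2.2,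
        (cdf_discr_le_iff hAB hμ hp hx hy).2 fun j hj => (h j hj).2.1⟩
  rw [levyInf, hset]
  refine sInf_le_iff_of_approx ⟨B - A, fun j _ => ellCond_length (quant_mem hAB) (hx.1 j)⟩
    (fun _ hy => (hy i hi).1) fun a h j hj => EllCond.of_approx fun ε hε => ?_
  obtain ⟨b, hb, hlt⟩ := h ε hε
  exact ⟨b, hb j hj, hlt⟩

lemma levyInf_le_iff_ell (hAB : A < B) (hμ : μ (Icc A B) = 1) (hp : IsPi n p)
    (hx : IsXi A B n x) {a : ℝ} : levyInf A B μ (discr n x p) ≤ a ↔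
      ∀ j : Fin n, psum n p j < psum n p ((j : ℕ) + 1) →
        ell (quantEReal μ A B) (psum n p j : ℝ) (psum n p ((j : ℕ) + 1) : ℝ) (x j) ≤ a := by
  rw [levyInf_le_iff hAB hμ hp hx]
  refine forall_congr' fun j => imp_congr ?_ (ell_le_iff (quant_mem hAB) (hx.1 j)).symm
  rw [psum_succ, lt_add_iff_pos_right]

lemma Lwei_le_levyInf (hAB : A < B) (hμ : μ (Icc A B) = 1) (hn : 0 < n) (hp : IsPi n p)
    (hx : IsXi A B n x) : Lwei μ A B n hn p ≤ levyInf A B μ (discr n x p) := by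
  rw [Lwei_le_iff hAB]
  intro j
  rcases (hp.1 j).lt_or_eq with hj | hj
  · exact ((levyInf_le_iff hAB hμ hp hx).1 le_rfl j hj).ellStarCond
  · have h0 : 0 ≤ levyInf A B μ (discr n x p) := Real.sInf_nonneg fun y hy => hy.1
    refine ⟨h0, fun s hs s' hs' => ?_⟩
    rw [psum_succ, ← hj] at hs
    linarith [quant_mono (μ := μ) hAB (show s ≤ s' by linarith)]

lemma exists_levyInf_le_Lwei (hAB : A < B) (hμ : μ (Icc A B) = 1) (hn : 0 < n) (hp : IsPi n p) :
    ∃ x : Fin n → ℝ, IsXi A B n x ∧ levyInf A B μ (discr n x p) ≤ Lwei μ A B n hn p := by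
  set L := Lwei μ A B n hn p with hL
  have hstar := (Lwei_le_iff hAB hn).1 hL.ge
  have hL0 : 0 ≤ L := (hstar ⟨0, hn⟩).1
  have hbdd (c : ℝ) : BddAbove (quant μ A B '' Iio c) :=
    ⟨B, forall_mem_image.2 fun s _ => (quant_mem hAB s).2⟩
  have hne (c : ℝ) : (quant μ A B '' Iio c).Nonempty := nonempty_Iio.image _
  have hx : IsXi A B n fun j => max A (quantm μ A B (psum n p ((j : ℕ) + 1) - L) - L) := by
    refine ⟨fun j => ⟨le_max_left _ _, max_le hAB.le ?_⟩, fun i j hij => max_le_max le_rfl ?_⟩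
    · have : quantm μ A B (psum n p ((j : ℕ) + 1) - L) ≤ B :=
        csSup_le (hne _) (forall_mem_image.2 fun s _ => (quant_mem hAB s).2)
      linarith
    · have hP : psum n p ((i : ℕ) + 1) ≤ psum n p ((j : ℕ) + 1) :=
        psum_mono hp (Nat.succ_le_succ hij)
      refine sub_le_sub_right (csSup_le_csSup (hbdd _) (hne _) (image_mono ?_)) _
      exact Iio_subset_Iio (by linarith)
  refine ⟨_, hx, (levyInf_le_iff hAB hμ hp hx).2 fun j _ => ⟨hL0, fun s hs => ?_, fun s hs => ?_⟩⟩
  · exact le_max_of_le_right (sub_le_sub_right (le_csSup (hbdd _) (mem_image_of_mem _ hs)) _)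
  · refine max_le (by linarith [(quant_mem (μ := μ) hAB s).1]) ?_
    rw [sub_le_iff_le_add]
    refine csSup_le (hne _) (forall_mem_image.2 fun r hr => ?_)
    linarith [(hstar j).2 r hr s hs]

end Levy

/-- Prop. 3.6: existence and characterization of best Lévy-distance
approximations of `μ` with prescribed weights `p ∈ Π_n`. -/
theorem best_dLevy_given_weights (A B : ℝ) (hAB : A < B) (μ : Measure ℝ)
    [IsProbabilityMeasure μ] (hμ : μ (Icc A B) = 1) (n : ℕ) (hn : 0 < n)
    (p : Fin n → ℝ) (hp : IsPi n p) :
    (∃ x : Fin n → ℝ, IsXi A B n x ∧ ∀ y : Fin n → ℝ, IsXi A B n y →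
      dLevy A B μ (discr n x p) ≤ dLevy A B μ (discr n y p)) ∧
    ∀ x : Fin n → ℝ, IsXi A B n x →
      (((∀ y : Fin n → ℝ, IsXi A B n y →
          dLevy A B μ (discr n x p) ≤ dLevy A B μ (discr n y p)) ↔
        (∀ j : Fin n, psum n p (j : ℕ) < psum n p ((j : ℕ) + 1) →
          ell (quantEReal μ A B)
              ((psum n p (j : ℕ) : ℝ) : EReal) ((psum n p ((j : ℕ) + 1) : ℝ) : EReal) (x j) ≤
            Lwei μ A B n hn p)) ∧
      ((∀ y : Fin n → ℝ, IsXi A B n y →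
          dLevy A B μ (discr n x p) ≤ dLevy A B μ (discr n y p)) →
        dLevy A B μ (discr n x p) = omegaI A B * Lwei μ A B n hn p)) := by
  have hω : 0 < omegaI A B := div_pos (lt_max_of_lt_left one_pos) (sub_pos.2 hAB)
  have hle (x y : Fin n → ℝ) : dLevy A B μ (discr n x p) ≤ dLevy A B μ (discr n y p) ↔
      levyInf A B μ (discr n x p) ≤ levyInf A B μ (discr n y p) := mul_le_mul_iff_right₀ hω
  obtain ⟨z, hz, hzL⟩ := exists_levyInf_le_Lwei hAB hμ hn hp
  have hmin (x : Fin n → ℝ) : (∀ y : Fin n → ℝ, IsXi A B n y →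
      dLevy A B μ (discr n x p) ≤ dLevy A B μ (discr n y p)) ↔
      levyInf A B μ (discr n x p) ≤ Lwei μ A B n hn p :=
    ⟨fun h => ((hle x z).1 (h z hz)).trans hzL,
      fun h y hy => (hle x y).2 (h.trans (Lwei_le_levyInf hAB hμ hn hp hy))⟩
  refine ⟨⟨z, hz, (hmin z).2 hzL⟩, fun x hx => ⟨?_, fun h => ?_⟩⟩
  · rw [hmin, levyInf_le_iff_ell hAB hμ hp hx]
  · exact congrArg (omegaI A B * ·)
      (le_antisymm ((hmin x).1 h) (Lwei_le_levyInf hAB hμ hn hp hx))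

end BenfordApprox
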